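/- Let F be a field of characteristic 0, d > 0 a real number in D₂(F), and k ≥ 2 an integer. Then d/k ∈ D₂(F) (Lemma 6). -/

import Mathlib

/-- `d ∈ D₂(F)`: `d` is a positive real such that for all `x, y ∈ ℝ²` with
`|x - y| = d` there is a finite set `S` with `{x, y} ⊆ S ⊆ ℝ²` such that every
unit-distance preserving map `f : S → F²` satisfies `φ₂(f x, f y) = d²`
(the value `d²` being interpreted in `F` via its rational value `q`). -/
def MemD2 (F : Type*) [Field F] (d : ℝ) : Prop :=
  0 < d ∧ ∃ q : ℚ, (q : ℝ) = d ^ 2 ∧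
    ∀ x y : EuclideanSpace ℝ (Fin 2), dist x y = d →
      ∃ S : Finset (EuclideanSpace ℝ (Fin 2)), ∃ hx : x ∈ S, ∃ hy : y ∈ S,
        ∀ f : S → (Fin 2 → F),
          (∀ u v : S,
            dist (u : EuclideanSpace ℝ (Fin 2)) (v : EuclideanSpace ℝ (Fin 2)) = 1 →
            ∑ i, (f u i - f v i) ^ 2 = 1) →
          ∑ i, (f ⟨x, hx⟩ i - f ⟨y, hy⟩ i) ^ 2 = (q : F)

namespace Lem6

abbrev P := EuclideanSpace ℝ (Fin 2)

/-- squared distance in `F²`. -/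
def Q {F : Type*} [Field F] (a b : Fin 2 → F) : F := (a 0 - b 0) ^ 2 + (a 1 - b 1) ^ 2

/-- The filter of total maps `f : ℝ² → F²`: a property is eventual when it is forced by
unit distance preservation on some finite set. -/
def L (F : Type*) [Field F] : Filter (P → Fin 2 → F) where
  sets := {R | ∃ S : Finset P, ∀ f : P → Fin 2 → F,
    (∀ u ∈ S, ∀ v ∈ S, dist u v = 1 → Q (f u) (f v) = 1) → f ∈ R}
  univ_sets := ⟨∅, fun _ _ => trivial⟩
  sets_of_superset := by
    rintro A B ⟨S, hS⟩ hAB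
    exact ⟨S, fun f hf => hAB (hS f hf)⟩
  inter_sets := by
    classical
    rintro A B ⟨S, hS⟩ ⟨T, hT⟩
    refine ⟨S ∪ T, fun f hf => ⟨hS f fun u hu v hv => hf u ?_ v ?_, hT f fun u hu v hv => hf u ?_ v ?_⟩⟩ <;>
      simp_all

lemma eventually_L {F : Type*} [Field F] (R : (P → Fin 2 → F) → Prop) :
    (∀ᶠ f in L F, R f) ↔ ∃ S : Finset P, ∀ f : P → Fin 2 → F,
    (∀ u ∈ S, ∀ v ∈ S, dist u v = 1 → Q (f u) (f v) = 1) → R f := Iff.rfl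

lemma dist_iff (x y : P) (d : ℝ) (hd : 0 ≤ d) :
    dist x y = d ↔ (x 0 - y 0) ^ 2 + (x 1 - y 1) ^ 2 = d ^ 2 := by
  rw [EuclideanSpace.dist_eq, Fin.sum_univ_two, Real.dist_eq, Real.dist_eq, sq_abs, sq_abs]
  rw [Real.sqrt_eq_iff_mul_self_eq (by positivity) hd]
  constructor <;> intro h <;> linarith

lemma forced_iff {F : Type*} [Field F] (x y : P) (c : F) :
    (∃ S : Finset P, ∃ hx : x ∈ S, ∃ hy : y ∈ S,
        ∀ f : S → (Fin 2 → F),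
          (∀ u v : S, dist (u : P) (v : P) = 1 → ∑ i, (f u i - f v i) ^ 2 = 1) →
          ∑ i, (f ⟨x, hx⟩ i - f ⟨y, hy⟩ i) ^ 2 = c) ↔
    ∀ᶠ f in L F, Q (f x) (f y) = c := by
  classical
  simp only [Fin.sum_univ_two]
  rw [eventually_L]
  constructor
  · rintro ⟨S, hx, hy, h⟩
    exact ⟨S, fun f hf => h (fun u => f u) fun u v huv => hf u u.2 v v.2 huv⟩
  · rintro ⟨S, h⟩
    refine ⟨insert x (insert y S), by simp, by simp, fun f hf => ?_⟩
    have := h (fun p => if hp : p ∈ insert x (insert y S) then f ⟨p, hp⟩ else 0) ?_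
    · simpa [Q] using this
    · intro u hu v hv huv
      have hu' : u ∈ insert x (insert y S) := by simp [hu]
      have hv' : v ∈ insert x (insert y S) := by simp [hv]
      simp only [dif_pos hu', dif_pos hv']
      exact hf ⟨u, hu'⟩ ⟨v, hv'⟩ huv

/-- Two equilateral triangles on a common side in `F²`. -/
lemma rhombus_alg {F : Type*} [Field F] [CharZero F] (q : F) (hq : q ≠ 0)
    (z a b c : Fin 2 → F) (h1 : Q z a = q) (h2 : Q z b = q) (h3 : Q a b = q)
    (h4 : Q c a = q) (h5 : Q c b = q) :
    c = z ∨ (c = a + b - z ∧ Q z c = 3 * q) := by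
  unfold Q at *
  obtain ⟨A0, hA0⟩ : ∃ t, t = a 0 - z 0 := ⟨_, rfl⟩
  obtain ⟨A1, hA1⟩ : ∃ t, t = a 1 - z 1 := ⟨_, rfl⟩
  obtain ⟨B0, hB0⟩ : ∃ t, t = b 0 - z 0 := ⟨_, rfl⟩
  obtain ⟨B1, hB1⟩ : ∃ t, t = b 1 - z 1 := ⟨_, rfl⟩
  obtain ⟨C0, hC0⟩ : ∃ t, t = c 0 - z 0 := ⟨_, rfl⟩
  obtain ⟨C1, hC1⟩ : ∃ t, t = c 1 - z 1 := ⟨_, rfl⟩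
  have e1 : A0 ^ 2 + A1 ^ 2 = q := by rw [← h1, hA0, hA1]; ring
  have e2 : B0 ^ 2 + B1 ^ 2 = q := by rw [← h2, hB0, hB1]; ring
  have e3 : 2 * (A0 * B0 + A1 * B1) = q := by
    have : (A0 - B0) ^ 2 + (A1 - B1) ^ 2 = q := by rw [← h3, hA0, hA1, hB0, hB1]; ring
    linear_combination e1 + e2 - this
  have e4 : C0 ^ 2 + C1 ^ 2 = 2 * (C0 * A0 + C1 * A1) := by
    have : (C0 - A0) ^ 2 + (C1 - A1) ^ 2 = q := by rw [← h4, hA0, hA1, hC0, hC1]; ring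
    linear_combination this - e1
  have e5 : C0 ^ 2 + C1 ^ 2 = 2 * (C0 * B0 + C1 * B1) := by
    have : (C0 - B0) ^ 2 + (C1 - B1) ^ 2 = q := by rw [← h5, hB0, hB1, hC0, hC1]; ring
    linear_combination this - e2
  have hD2 : 4 * (A0 * B1 - A1 * B0) ^ 2 = 3 * q ^ 2 := by
    have : (A0 * B1 - A1 * B0) ^ 2 =
      (A0 ^ 2 + A1 ^ 2) * (B0 ^ 2 + B1 ^ 2) - (A0 * B0 + A1 * B1) ^ 2 := by ring
    rw [this, e1, e2]
    linear_combination (-(2 * (A0 * B0 + A1 * B1)) - q) * e3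
  have hD : A0 * B1 - A1 * B0 ≠ 0 := by
    intro h
    rw [h] at hD2
    have : q ^ 2 = 0 := by linear_combination (-1 / 3 : F) * hD2
    exact hq (by simpa using this)
  obtain ⟨s, hs⟩ : ∃ s, s = (C0 * B1 - C1 * B0) / (A0 * B1 - A1 * B0) := ⟨_, rfl⟩
  obtain ⟨t, ht⟩ : ∃ t, t = (A0 * C1 - A1 * C0) / (A0 * B1 - A1 * B0) := ⟨_, rfl⟩
  have hs' : s * (A0 * B1 - A1 * B0) = C0 * B1 - C1 * B0 := by rw [hs, div_mul_cancel₀ _ hD]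
  have ht' : t * (A0 * B1 - A1 * B0) = A0 * C1 - A1 * C0 := by rw [ht, div_mul_cancel₀ _ hD]
  have hc0 : C0 = s * A0 + t * B0 := by
    apply mul_right_cancel₀ hD
    linear_combination -A0 * hs' - B0 * ht'
  have hc1 : C1 = s * A1 + t * B1 := by
    apply mul_right_cancel₀ hD
    linear_combination -A1 * hs' - B1 * ht'
  have hst : s = t := by
    have h0 : q * (s - t) = 0 := by
      rw [hc0, hc1] at e4 e5
      linear_combination e5 - e4 - 2 * s * e1 + s * e3 - t * e3 + 2 * t * e2
    have := (mul_eq_zero.1 h0).resolve_left hq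
    exact sub_eq_zero.1 this
  subst hst
  have h6 : (3 * q) * (s * (s - 1)) = 0 := by
    rw [hc0, hc1] at e4 e5
    linear_combination e4 - s ^ 2 * (e1 + e2 + e3) + 2 * s * e1 + s * e3
  have h3q : (3 * q) ≠ 0 := mul_ne_zero (by norm_num) hq
  rcases mul_eq_zero.1 ((mul_eq_zero.1 h6).resolve_left h3q) with h | h
  · left
    rw [h] at hc0 hc1
    ext i; fin_cases i
    · simp only [Fin.zero_eta]; linear_combination hc0 - hC0
    · simp only [Fin.mk_one]; linear_combination hc1 - hC1
  · right
    have h := sub_eq_zero.1 h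
    rw [h] at hc0 hc1
    constructor
    · ext i; fin_cases i
      · simp only [Fin.zero_eta, Pi.sub_apply, Pi.add_apply]; linear_combination hc0 - hC0 + hA0 + hB0
      · simp only [Fin.mk_one, Pi.sub_apply, Pi.add_apply]; linear_combination hc1 - hC1 + hA1 + hB1
    · have : (z 0 - c 0) ^ 2 + (z 1 - c 1) ^ 2 = C0 ^ 2 + C1 ^ 2 := by rw [hC0, hC1]; ring
      rw [this, hc0, hc1]
      linear_combination e1 + e2 + e3

/-- similarity `u ↦ (c + s i) u`. -/
noncomputable def rot (c s : ℝ) (u : P) : P := !₂[c * u 0 - s * u 1, s * u 0 + c * u 1]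

@[simp] lemma rot0 (c s : ℝ) (u : P) : rot c s u 0 = c * u 0 - s * u 1 := by simp [rot]
@[simp] lemma rot1 (c s : ℝ) (u : P) : rot c s u 1 = s * u 0 + c * u 1 := by simp [rot]

noncomputable def R : P → P := rot (1 / 2) (√3 / 2)
noncomputable def T : P → P := rot (5 / 6) (√11 / 6)

section
variable {F : Type*} [Field F] [CharZero F] {d : ℝ} {q : F}

lemma rhombus1 (hd : 0 < d) (hq : q ≠ 0)
    (H : ∀ x y : P, dist x y = d → ∀ᶠ f in L F, Q (f x) (f y) = q)
    (z u : P) (hu : u 0 ^ 2 + u 1 ^ 2 = d ^ 2) :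
    ∀ᶠ f in L F, f (z + u + R u) = f z ∨
      (f (z + u + R u) = f (z + u) + f (z + R u) - f z ∧ Q (f z) (f (z + u + R u)) = 3 * q) := by
  have s3 : √3 ^ 2 = (3 : ℝ) := Real.sq_sqrt (by norm_num)
  have g1 := H z (z + u) (by rw [dist_iff _ _ _ hd.le]; simp; linarith)
  have g2 := H z (z + R u) (by
    rw [dist_iff _ _ _ hd.le]; simp [R]; linear_combination hu + (u 0 ^ 2 + u 1 ^ 2) / 4 * s3)
  have g3 := H (z + u) (z + R u) (by
    rw [dist_iff _ _ _ hd.le]; simp [R]; linear_combination hu + (u 0 ^ 2 + u 1 ^ 2) / 4 * s3)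
  have g4 := H (z + u + R u) (z + u) (by
    rw [dist_iff _ _ _ hd.le]; simp [R]; linear_combination hu + (u 0 ^ 2 + u 1 ^ 2) / 4 * s3)
  have g5 := H (z + u + R u) (z + R u) (by
    rw [dist_iff _ _ _ hd.le]; simp; linarith)
  filter_upwards [g1, g2, g3, g4, g5] with f h1 h2 h3 h4 h5
  exact rhombus_alg q hq _ _ _ _ h1 h2 h3 h4 h5

lemma rhombus (hd : 0 < d) (hq : q ≠ 0)
    (H : ∀ x y : P, dist x y = d → ∀ᶠ f in L F, Q (f x) (f y) = q)
    (z u : P) (hu : u 0 ^ 2 + u 1 ^ 2 = d ^ 2) :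
    ∀ᶠ f in L F, f (z + u + R u) = f (z + u) + f (z + R u) - f z := by
  have s3 : √3 ^ 2 = (3 : ℝ) := Real.sq_sqrt (by norm_num)
  have s11 : √11 ^ 2 = (11 : ℝ) := Real.sq_sqrt (by norm_num)
  have g1 := rhombus1 hd hq H z u hu
  have g2 := rhombus1 hd hq H z (T u) (by
    simp [T]; linear_combination hu + (u 0 ^ 2 + u 1 ^ 2) / 36 * s11)
  have g3 := H (z + u + R u) (z + T u + R (T u)) (by
    rw [dist_iff _ _ _ hd.le]; simp [R, T]
    linear_combination hu + (u 0 ^ 2 + u 1 ^ 2) * (1 / 4 * (1 / 36) * (√11 ^ 2 + 1) * s3 + (9 + 3) / 4 / 36 * s11))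
  filter_upwards [g1, g2, g3] with f h1 h2 h3
  rcases h1 with h1 | h1
  · exfalso
    rw [h1] at h3
    rcases h2 with h2 | h2
    · rw [h2] at h3
      apply hq; rw [← h3]; simp [Q]
    · rw [h2.2] at h3
      apply hq; linear_combination h3 / 2
  · exact h1.1

lemma step (hd : 0 < d) (hq : q ≠ 0)
    (H : ∀ x y : P, dist x y = d → ∀ᶠ f in L F, Q (f x) (f y) = q)
    (z u : P) (hu : u 0 ^ 2 + u 1 ^ 2 = d ^ 2) :
    ∀ᶠ f in L F, f (z + u + u) = f (z + u) + f (z + u) - f z := by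
  have s3 : √3 ^ 2 = (3 : ℝ) := Real.sq_sqrt (by norm_num)
  have g1 := rhombus hd hq H z u hu
  -- the rhombus with apex `z + R u` and sides `u - R u`, `u`
  have g2 := rhombus hd hq H (z + R u) (u - R u) (by
    simp [R]; linear_combination hu + (u 0 ^ 2 + u 1 ^ 2) / 4 * s3)
  have e : R (u - R u) = u := by
    ext i; fin_cases i
    · simp [R]; linear_combination (u 0) / 4 * s3
    · simp [R]; linear_combination (u 1) / 4 * s3
  rw [e] at g2
  have e1 : z + R u + (u - R u) = z + u := by abel
  have e2 : z + R u + u = z + u + R u := by abel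
  rw [e1, e2] at g2
  filter_upwards [g1, g2] with f h1 h2
  rw [h2, h1]; abel

lemma mult (hd : 0 < d) (hq : q ≠ 0)
    (H : ∀ x y : P, dist x y = d → ∀ᶠ f in L F, Q (f x) (f y) = q)
    (z u : P) (hu : u 0 ^ 2 + u 1 ^ 2 = d ^ 2) (n : ℕ) :
    ∀ᶠ f in L F, f (z + (n : ℝ) • u) = f z + (n : F) • (f (z + u) - f z) := by
  induction n using Nat.twoStepInduction with
  | zero => simp
  | one => simp
  | more n h1 h2 =>
    have g := step hd hq H (z + (n : ℝ) • u) u hu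
    have e1 : z + (n : ℝ) • u + u = z + ((n + 1 : ℕ) : ℝ) • u := by push_cast; module
    have e2 : z + ((n + 1 : ℕ) : ℝ) • u + u = z + ((n + 2 : ℕ) : ℝ) • u := by push_cast; module
    rw [e1, e2] at g
    filter_upwards [h1, h2, g] with f h1 h2 h3
    rw [h3, h1, h2]; push_cast; module

end

end Lem6

open Lem6 in
/-- **Lemma 6.** If `d ∈ D₂(F)` then `d / k ∈ D₂(F)` for every integer `k ≥ 2`. -/
theorem stmt_14 (F : Type*) [Field F] [CharZero F] (d : ℝ) (hd : MemD2 F d)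
    (k : ℕ) (hk : 2 ≤ k) :
    MemD2 F (d / k) := by
  obtain ⟨hd, q, hq, H⟩ := hd
  have hk0 : (0 : ℝ) < k := by positivity
  have hk1 : (2 : ℝ) ≤ k := by exact_mod_cast hk
  have hkF : (k : F) ≠ 0 := by
    have : k ≠ 0 := by omega
    exact_mod_cast this
  have hq0 : (q : F) ≠ 0 := by
    have : (q : ℝ) ≠ 0 := by rw [hq]; positivity
    have : q ≠ 0 := by exact_mod_cast this
    exact_mod_cast this
  have H' : ∀ x y : P, dist x y = d → ∀ᶠ f in L F, Q (f x) (f y) = (q : F) :=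
    fun x y h => (forced_iff x y _).1 (H x y h)
  refine ⟨by positivity, q / k ^ 2, by push_cast; rw [hq]; ring, fun x y hxy => ?_⟩
  refine (forced_iff x y _).2 ?_
  rw [dist_iff _ _ _ (by positivity)] at hxy
  have hxy' : ((x 0 - y 0) ^ 2 + (x 1 - y 1) ^ 2) * k ^ 2 = d ^ 2 := by
    rw [hxy]; field_simp
  obtain ⟨t, ht⟩ : ∃ t : ℝ, t ^ 2 = k ^ 2 - 1 / 4 :=
    ⟨√(k ^ 2 - 1 / 4), Real.sq_sqrt (by nlinarith)⟩
  obtain ⟨z, hz⟩ : ∃ z : P, z = y + rot (1 / 2) t (x - y) := ⟨_, rfl⟩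
  have hz0 : z 0 = y 0 + (1 / 2 * (x 0 - y 0) - t * (x 1 - y 1)) := by rw [hz]; simp
  have hz1 : z 1 = y 1 + (t * (x 0 - y 0) + 1 / 2 * (x 1 - y 1)) := by rw [hz]; simp
  have g1 := mult hd hq0 H' z (x - z) (by
    simp only [PiLp.sub_apply]; rw [hz0, hz1]
    linear_combination hxy' + ((x 0 - y 0) ^ 2 + (x 1 - y 1) ^ 2) * ht) k
  have g2 := mult hd hq0 H' z (y - z) (by
    simp only [PiLp.sub_apply]; rw [hz0, hz1]
    linear_combination hxy' + ((x 0 - y 0) ^ 2 + (x 1 - y 1) ^ 2) * ht) k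
  have g3 := H' (z + (k : ℝ) • (x - z)) (z + (k : ℝ) • (y - z)) (by
    rw [dist_iff _ _ _ hd.le]; simp; linear_combination hxy')
  rw [add_sub_cancel] at g1 g2
  filter_upwards [g1, g2, g3] with f h1 h2 h3
  rw [h1, h2] at h3
  push_cast
  rw [eq_div_iff (by positivity), ← h3]
  simp [Q]; ring
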